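/- (Gross–Sullivant k-core upper bound) Let G be a graph on vertex set {1,…,p} with edge set E, and let n be a positive integer. Suppose that every nonempty subgraph of G induced on a subset of vertices has a vertex whose degree in that induced subgraph is strictly less than n (equivalently, the n-core of G is empty). Then for Lebesgue-almost every X ∈ ℝ^{p×n}, the function K ↦ Tr(X Xᵀ K) − log(det K) attains a minimum on the Gaussian graphical model M_G. -/

import Mathlib

open Matrix MeasureTheory

/-- The Gaussian graphical model of a graph `G`: real symmetric positive definite matrices
whose off-diagonal entries vanish on non-edges of `G`. -/
def gaussianModel {p : ℕ} (G : SimpleGraph (Fin p)) : Set (Matrix (Fin p) (Fin p) ℝ) :=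
  {K | K.PosDef ∧ ∀ i j : Fin p, i ≠ j → ¬ G.Adj i j → K i j = 0}

/-- A measurable set of families is null as soon as all its sections along one coordinate are. -/
theorem measure_pi_eq_zero_of_update {ι E : Type*} [Fintype ι] [DecidableEq ι]
    [MeasurableSpace E] (μ : Measure E) [SigmaFinite μ]
    {B : Set (ι → E)} (hB : MeasurableSet B) (v : ι)
    (h : ∀ x : ι → E, μ {y | Function.update x v y ∈ B} = 0) :
    Measure.pi (fun _ : ι => μ) B = 0 := by
  rcases B.eq_empty_or_nonempty with rfl | ⟨e, -⟩
  · exact measure_empty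
  have hf : Measurable (B.indicator (1 : (ι → E) → ENNReal)) := measurable_one.indicator hB
  rw [← lintegral_indicator_one hB, lintegral_eq_lmarginal_univ e,
    lmarginal_erase' _ hf (Finset.mem_univ v)]
  have hz : (fun x : ι → E =>
      ∫⁻ y, B.indicator (1 : (ι → E) → ENNReal) (Function.update x v y) ∂μ) = fun _ => 0 := by
    funext x
    have hm : MeasurableSet {y | Function.update x v y ∈ B} := measurable_update x hB
    rw [← h x, ← lintegral_indicator_one hm]
    rfl
  rw [hz]
  simp [lmarginal]

theorem isOpen_setOf_linearIndepOn {ι E : Type*} [Finite ι] [NormedAddCommGroup E]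
    [NormedSpace ℝ E] (s : Set ι) :
    IsOpen {x : ι → E | LinearIndepOn ℝ x s} := by
  have hc : Continuous fun (x : ι → E) (i : s) => x i := by fun_prop
  exact (isOpen_setOfPred_linearIndependent (𝕜 := ℝ) (E := E) (ι := s)).preimage hc

/-- Almost every family of vectors is linearly independent along any fixed index set whose size
is at most the dimension. -/
theorem ae_linearIndepOn {ι E : Type*} [Fintype ι] [NormedAddCommGroup E] [NormedSpace ℝ E]
    [FiniteDimensional ℝ E] [MeasurableSpace E] [BorelSpace E] (μ : Measure E) [μ.IsAddHaarMeasure] (s : Finset ι)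
    (hs : s.card ≤ Module.finrank ℝ E) :
    ∀ᵐ x ∂(Measure.pi fun _ : ι => μ), LinearIndepOn ℝ x (s : Set ι) := by
  classical
  induction s using Finset.induction_on with
  | empty => simp
  | insert v s hv ih =>
    rw [Finset.card_insert_of_notMem hv] at hs
    set B : Set (ι → E) := {x | LinearIndepOn ℝ x (s : Set ι)} ∩
      {x | LinearIndepOn ℝ x ((insert v s : Finset ι) : Set ι)}ᶜ with hBdef
    have hB : MeasurableSet B := (isOpen_setOf_linearIndepOn _).measurableSet.inter
      (isOpen_setOf_linearIndepOn _).measurableSet.compl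
    have hnull : Measure.pi (fun _ : ι => μ) B = 0 := by
      refine measure_pi_eq_zero_of_update μ hB v fun x => ?_
      have htop : Submodule.span ℝ (x '' (s : Set ι)) ≠ ⊤ := by
        intro h
        have h1 := finrank_span_finset_le_card (R := ℝ) (s.image x)
        rw [Finset.coe_image, Set.finrank, h, finrank_top] at h1
        have := Finset.card_image_le (s := s) (f := x)
        omega
      refine measure_mono_null (fun y hy => ?_) (Measure.addHaar_submodule μ _ htop)
      obtain ⟨h1, h2⟩ := hy
      have himg : Function.update x v y '' (s : Set ι) = x '' (s : Set ι) :=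
        Set.image_congr fun i hi =>
          Function.update_of_ne (by rintro rfl; exact hv hi) _ _
      simp only [Set.mem_compl_iff, Set.mem_ofPred_eq, Finset.coe_insert] at h1 h2
      rw [linearIndepOn_insert (by simpa using hv)] at h2
      by_contra h3
      exact h2 ⟨h1, by simpa [himg] using h3⟩
    filter_upwards [ih (by omega), measure_eq_zero_iff_ae_notMem.1 hnull] with x h1 h2
    by_contra h3
    exact h2 ⟨h1, h3⟩

/-- If every nonempty induced subgraph has a vertex of degree less than `n` and any `n` rows of
`X` are linearly independent, then no nonzero symmetric matrix with zero pattern `G`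
annihilates `X`. -/
theorem eq_zero_of_mul_eq_zero_of_core_empty {V m : Type*} [Fintype V] [Fintype m] {n : ℕ}
    (G : SimpleGraph V) [DecidableRel G.Adj]
    (hcore : ∀ s : Finset V, s.Nonempty →
      ∃ v ∈ s, (s.filter (fun u => G.Adj v u)).card < n)
    {X : Matrix V m ℝ}
    (hX : ∀ s : Finset V, s.card ≤ n → LinearIndepOn ℝ X.row (s : Set V))
    {K : Matrix V V ℝ} (hK : K.IsSymm) (hpat : ∀ i j, i ≠ j → ¬ G.Adj i j → K i j = 0)
    (hKX : K * X = 0) : K = 0 := by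
  classical
  suffices H : ∀ s : Finset V, (∀ i j, i ∉ s → K i j = 0) → K = 0 from
    H Finset.univ (by simp)
  intro s
  induction s using Finset.strongInduction with
  | H s ih =>
    intro hs
    rcases s.eq_empty_or_nonempty with rfl | hne
    · ext i j
      exact hs i j (by simp)
    obtain ⟨v, hv, hdeg⟩ := hcore s hne
    refine ih (s.erase v) (Finset.erase_ssubset hv) fun i j hi => ?_
    by_cases his : i ∈ s
    swap
    · exact hs i j his
    obtain rfl : i = v := by
      by_contra h
      exact hi (Finset.mem_erase.2 ⟨h, his⟩)
    set t := insert i (s.filter (fun u => G.Adj i u)) with ht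
    have hout : ∀ u, u ∉ t → K i u = 0 := by
      intro u hu
      simp only [ht, Finset.mem_insert, Finset.mem_filter, not_or, not_and] at hu
      by_cases hus : u ∈ s
      · exact hpat i u (Ne.symm hu.1) (hu.2 hus)
      · rw [← hK.apply]
        exact hs u i hus
    by_cases hj : j ∈ t
    swap
    · exact hout j hj
    have hli := hX t ((Finset.card_insert_le _ _).trans hdeg)
    rw [linearIndepOn_finset_iff] at hli
    refine hli (K i) ?_ j hj
    rw [Finset.sum_subset (Finset.subset_univ t) fun u _ hu => by rw [hout u hu, zero_smul]]
    ext k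
    have := congrFun (congrFun hKX i) k
    simpa [Matrix.mul_apply, Finset.sum_apply] using this

section PosSemidef

variable {V m : Type*} [Fintype V] [Fintype m]

theorem Matrix.PosSemidef.abs_apply_le_trace {K : Matrix V V ℝ}
    (hK : K.PosSemidef) (i j : V) : |K i j| ≤ K.trace := by
  classical
  have hdiag : ∀ i, K i i ≤ K.trace := fun i =>
    Finset.single_le_sum (f := fun i => K i i) (fun i _ => hK.diag_nonneg) (Finset.mem_univ i)
  have hsymm : K j i = K i j := by simpa using hK.isHermitian.apply i j
  have h1 := hK.dotProduct_mulVec_nonneg (Pi.single i 1 + Pi.single j 1)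
  have h2 := hK.dotProduct_mulVec_nonneg (Pi.single i 1 - Pi.single j 1)
  simp [Matrix.mulVec_add, Matrix.mulVec_sub, add_dotProduct, sub_dotProduct,
    dotProduct_add, dotProduct_sub, hsymm] at h1 h2
  rw [abs_le]
  constructor <;> linarith [hdiag i, hdiag j]

theorem isClosed_setOf_posSemidef : IsClosed {K : Matrix V V ℝ | K.PosSemidef} := by
  simp only [posSemidef_iff_dotProduct_mulVec, Set.ofPred_and, Set.ofPred_forall]
  refine IsClosed.inter (isClosed_eq (by fun_prop) (by fun_prop)) (isClosed_iInter fun x => ?_)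
  exact isClosed_le (by fun_prop) (by fun_prop)

theorem isCompact_setOf_posSemidef_trace_le (R : ℝ) :
    IsCompact {K : Matrix V V ℝ | K.PosSemidef ∧ K.trace ≤ R} := by
  have hbox : IsCompact
      (Set.univ.pi fun _ : V => Set.univ.pi fun _ : V => Set.Icc (-R) R) :=
    isCompact_univ_pi fun _ => isCompact_univ_pi fun _ => isCompact_Icc
  refine IsCompact.of_isClosed_subset (X := Matrix V V ℝ) hbox ?_ ?_
  · exact isClosed_setOf_posSemidef.inter
      (isClosed_le (f := fun K : Matrix V V ℝ => K.trace) (by fun_prop) continuous_const)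
  · rintro K ⟨hK, hR⟩ i - j -
    exact abs_le.1 ((hK.abs_apply_le_trace i j).trans hR)

theorem Matrix.PosSemidef.trace_mul_transpose_mul_nonneg {K : Matrix V V ℝ}
    (hK : K.PosSemidef) (X : Matrix V m ℝ) : 0 ≤ (X * Xᵀ * K).trace := by
  rw [Matrix.mul_assoc, Matrix.trace_mul_comm]
  simpa using (hK.conjTranspose_mul_mul_same X).trace_nonneg

theorem Matrix.PosSemidef.mul_eq_zero_of_trace_eq_zero {K : Matrix V V ℝ}
    (hK : K.PosSemidef) {X : Matrix V m ℝ} (h : (X * Xᵀ * K).trace = 0) : K * X = 0 := by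
  classical
  rw [Matrix.mul_assoc, Matrix.trace_mul_comm] at h
  have h0 : Xᵀ * K * X = 0 := by
    simpa using (hK.conjTranspose_mul_mul_same X).trace_eq_zero_iff.1 (by simpa using h)
  ext i k
  have hk := congrFun (congrFun h0 k) k
  have := (hK.dotProduct_mulVec_zero_iff (X.col k)).1 <| by
    rw [Matrix.mul_assoc] at hk
    simpa [Matrix.mul_apply, dotProduct, Matrix.mulVec] using hk
  simpa [Matrix.mul_apply, dotProduct, Matrix.mulVec] using congrFun this i

/-- The tangent line bound for the logarithm, summed over the eigenvalues. -/
theorem Matrix.PosDef.log_det_le [DecidableEq V] {K : Matrix V V ℝ} (hK : K.PosDef) {a : ℝ}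
    (ha : 0 < a) : Real.log K.det ≤ a * K.trace - Fintype.card V * (1 + Real.log a) := by
  have hpos := hK.eigenvalues_pos
  rw [hK.isHermitian.det_eq_prod_eigenvalues, hK.isHermitian.trace_eq_sum_eigenvalues]
  simp only [RCLike.ofReal_real_eq_id, id]
  rw [Real.log_prod (fun i _ => (hpos i).ne'), Finset.mul_sum, ← nsmul_eq_mul,
    ← Finset.card_univ, ← Finset.sum_const, ← Finset.sum_sub_distrib]
  refine Finset.sum_le_sum fun i _ => ?_
  have := Real.log_le_sub_one_of_pos (mul_pos ha (hpos i))
  rw [Real.log_mul ha.ne' (hpos i).ne'] at this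
  linarith

end PosSemidef

/-- If `K ↦ Tr (X Xᵀ K)` is positive on nonzero positive semidefinite matrices with zero pattern
`G`, then the Gaussian log-likelihood attains its maximum on the model. -/
theorem exists_isMinOn_gaussianModel {p : ℕ} {m : Type*} [Fintype m] (G : SimpleGraph (Fin p))
    (X : Matrix (Fin p) m ℝ)
    (hX : ∀ K : Matrix (Fin p) (Fin p) ℝ, K.PosSemidef →
      (∀ i j, i ≠ j → ¬ G.Adj i j → K i j = 0) → K * X = 0 → K = 0) :
    ∃ K ∈ gaussianModel G, IsMinOn (fun K : Matrix (Fin p) (Fin p) ℝ =>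
      (X * Xᵀ * K).trace - Real.log K.det) (gaussianModel G) K := by
  set f : Matrix (Fin p) (Fin p) ℝ → ℝ := fun K => (X * Xᵀ * K).trace - Real.log K.det
  set L : Set (Matrix (Fin p) (Fin p) ℝ) :=
    {K | ∀ i j, i ≠ j → ¬ G.Adj i j → K i j = 0} with hL
  have hLc : IsClosed L := by
    simp only [hL, Set.ofPred_forall]
    exact isClosed_iInter fun i => isClosed_iInter fun j => isClosed_iInter fun _ =>
      isClosed_iInter fun _ => isClosed_eq (by fun_prop) (by fun_prop)
  obtain ⟨c, hc, hcoer⟩ : ∃ c : ℝ, 0 < c ∧ ∀ K : Matrix (Fin p) (Fin p) ℝ,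
      K.PosSemidef → K ∈ L → c * K.trace ≤ (X * Xᵀ * K).trace := by
    set S : Set (Matrix (Fin p) (Fin p) ℝ) :=
      {K | K.PosSemidef ∧ K.trace ≤ 1} ∩ (L ∩ {K | K.trace = 1})
    have hS : IsCompact S := (isCompact_setOf_posSemidef_trace_le 1).inter_right
      (hLc.inter (isClosed_eq (by fun_prop) (by fun_prop)))
    obtain ⟨c, hc, hcS⟩ : ∃ c : ℝ, 0 < c ∧ ∀ K ∈ S, c ≤ (X * Xᵀ * K).trace := by
      rcases S.eq_empty_or_nonempty with hem | hne
      · exact ⟨1, one_pos, by simp [hem]⟩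
      obtain ⟨K₀, hK₀, hmin⟩ := hS.exists_isMinOn (f := fun K => (X * Xᵀ * K).trace) hne
        (by fun_prop)
      refine ⟨_, lt_of_le_of_ne (hK₀.1.1.trace_mul_transpose_mul_nonneg X) fun h => ?_, hmin⟩
      have h0 := hX K₀ hK₀.1.1 hK₀.2.1 (hK₀.1.1.mul_eq_zero_of_trace_eq_zero h.symm)
      have h1 : K₀.trace = 1 := hK₀.2.2
      simp [h0] at h1
    refine ⟨c, hc, fun K hK hKL => ?_⟩
    rcases hK.trace_nonneg.eq_or_lt with h0 | hpos
    · rw [← h0, mul_zero]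
      exact hK.trace_mul_transpose_mul_nonneg X
    have htr : (K.trace⁻¹ • K).trace = 1 := by
      rw [Matrix.trace_smul, smul_eq_mul, inv_mul_cancel₀ hpos.ne']
    have := hcS (K.trace⁻¹ • K) ⟨⟨hK.smul (inv_nonneg.2 hpos.le), htr.le⟩,
      fun i j hij hadj => by simp [hKL i j hij hadj], htr⟩
    rw [Matrix.mul_smul, Matrix.trace_smul, smul_eq_mul, inv_mul_eq_div, le_div_iff₀ hpos] at this
    exact this
  have hone : (1 : Matrix (Fin p) (Fin p) ℝ) ∈ gaussianModel G :=
    ⟨.one, fun i j hij _ => Matrix.one_apply_ne hij⟩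
  obtain ⟨a, ha, hac⟩ : ∃ a : ℝ, 0 < a ∧ a < c := ⟨c / 2, by linarith, by linarith⟩
  set R : ℝ := (f 1 - p * (1 + Real.log a)) / (c - a)
  set D : Set (Matrix (Fin p) (Fin p) ℝ) := {K | K.PosSemidef ∧ K.trace ≤ R} ∩
    (L ∩ {K | Real.exp (-f 1) ≤ K.det}) with hD
  have hDc : IsCompact D := (isCompact_setOf_posSemidef_trace_le R).inter_right
    (hLc.inter (isClosed_le (by fun_prop) (by fun_prop)))
  have hdet : ∀ K ∈ D, 0 < K.det := fun K hK => (Real.exp_pos _).trans_le hK.2.2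
  have hsub : ∀ K ∈ gaussianModel G, f K ≤ f 1 → K ∈ D := by
    intro K hK hle
    have h1 := hcoer K hK.1.posSemidef hK.2
    have h2 := hK.1.log_det_le ha
    have h3 := hK.1.posSemidef.trace_mul_transpose_mul_nonneg X
    have hfK : f K = (X * Xᵀ * K).trace - Real.log K.det := rfl
    rw [Fintype.card_fin] at h2
    refine ⟨⟨hK.1.posSemidef, ?_⟩, hK.2, ?_⟩
    · rw [le_div_iff₀ (by linarith)]
      linarith
    · exact (Real.le_log_iff_exp_le hK.1.det_pos).1 (by linarith)
  have hDG : D ⊆ gaussianModel G := fun K hK =>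
    ⟨hK.1.1.posDef_iff_det_ne_zero.2 (hdet K hK).ne', hK.2.1⟩
  have hcont : ContinuousOn f D := ContinuousOn.sub (by fun_prop)
    (ContinuousOn.log (by fun_prop) fun K hK => (hdet K hK).ne')
  obtain ⟨K₀, hK₀, hmin⟩ := hDc.exists_isMinOn ⟨1, hsub 1 hone le_rfl⟩ hcont
  refine ⟨K₀, hDG hK₀, fun K hK => ?_⟩
  rcases le_total (f K) (f 1) with h | h
  · exact hmin (hsub K hK h)
  · exact (hmin (hsub 1 hone le_rfl)).trans h

/-- (Gross–Sullivant `k`-core upper bound.) If every nonempty induced subgraph of `G`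
has a vertex of degree strictly less than `n` (i.e. the `n`-core of `G` is empty),
then for almost every `X ∈ ℝ^{p×n}` the function `K ↦ Tr(X Xᵀ K) − log det K`
attains a minimum on `M_G`. -/
theorem core_upper_bound_mlt (p n : ℕ) (hn : 0 < n)
    (G : SimpleGraph (Fin p)) [DecidableRel G.Adj]
    (hcore : ∀ s : Finset (Fin p), s.Nonempty →
      ∃ v ∈ s, (s.filter (fun u => G.Adj v u)).card < n) :
    volume {X : Fin p → Fin n → ℝ | ¬ ∃ K ∈ gaussianModel G,
      IsMinOn (fun K : Matrix (Fin p) (Fin p) ℝ =>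
          (Matrix.of X * (Matrix.of X)ᵀ * K).trace - Real.log K.det)
        (gaussianModel G) K} = 0 := by
  have hae : ∀ᵐ X : Fin p → Fin n → ℝ, ∀ s : Finset (Fin p), s.card ≤ n →
      LinearIndepOn ℝ X (s : Set (Fin p)) := by
    rw [ae_all_iff]
    intro s
    by_cases hs : s.card ≤ n
    · filter_upwards [ae_linearIndepOn (volume : Measure (Fin n → ℝ)) s (by simpa using hs)]
        with X hX _ using hX
    · exact .of_forall fun X h => absurd h hs
  refine ae_iff.1 (hae.mono fun X hX => ?_)
  exact exists_isMinOn_gaussianModel G (Matrix.of X) fun K hK hpat hKX =>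
    eq_zero_of_mul_eq_zero_of_core_empty G hcore hX
      (by simpa [Matrix.IsSymm] using hK.isHermitian.eq) hpat hKX
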